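/- Fractional integration by parts identities: let α ≥ 0 and let φ : ℝ → ℝ be a Schwartz function. Then (i) ∫_ℝ φ(x)·(D^α φ)(x) dx = ∫_ℝ ((D^{α/2}φ)(x))² dx; (ii) ∫_ℝ x·φ'(x)·(D^α φ)(x) dx = ((α−1)/2)·∫_ℝ ((D^{α/2}φ)(x))² dx; and (iii) ∫_ℝ x²·φ''(x)·(D^α φ)(x) dx = −∫_ℝ x²·((D^{α/2}φ')(x))² dx + ((α−2)²/4)·∫_ℝ ((D^{α/2}φ)(x))² dx. -/

import Mathlib

open MeasureTheory

noncomputable section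

/-- The one-dimensional Fourier transform with kernel `e^{-2πi x ξ}` (Bochner integral). -/
def FT1 (f : ℝ → ℂ) (ξ : ℝ) : ℂ :=
  ∫ x : ℝ, Complex.exp (-(2 * Real.pi * Complex.I) * ((x * ξ : ℝ) : ℂ)) * f x

/-- The fractional derivative `D^β f (x) = ∫ |ξ|^β f̂(ξ) e^{2πi x ξ} dξ`. -/
def Dop (β : ℝ) (f : ℝ → ℝ) (x : ℝ) : ℂ :=
  ∫ ξ : ℝ, ((|ξ| ^ β : ℝ) : ℂ) * FT1 (fun t => (f t : ℂ)) ξ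
    * Complex.exp ((2 * Real.pi * Complex.I) * ((x * ξ : ℝ) : ℂ))

open scoped FourierTransform SchwartzMap ContDiff ComplexConjugate

theorem Dop_eq_fourierInv (β : ℝ) (f : ℝ → ℝ) (x : ℝ) :
    Dop β f x = 𝓕⁻ (fun ξ : ℝ => ((|ξ| ^ β : ℝ) : ℂ) * 𝓕 (fun t : ℝ => (f t : ℂ)) ξ) x := by
  have h : FT1 (fun t => (f t : ℂ)) = 𝓕 (fun t : ℝ => (f t : ℂ)) := by
    ext ξ
    rw [Real.fourier_real_eq_integral_exp_smul, FT1]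
    congr 1
    ext v
    rw [smul_eq_mul]
    congr 2
    push_cast
    ring
  rw [Dop, Real.fourierInv_eq', h]
  congr 1
  ext ξ
  rw [smul_eq_mul, mul_comm]
  congr 2
  simp
  ring

theorem integral_fourier_mul_eq_flip {f g : ℝ → ℂ} (hf : Integrable f) (hg : Integrable g) :
    ∫ ξ, 𝓕 f ξ * g ξ = ∫ x, f x * 𝓕 g x := by
  have := VectorFourier.integral_fourierIntegral_smul_eq_flip (μ := volume) (ν := volume)
    (L := innerₗ ℝ) Real.continuous_fourierChar continuous_inner hf hg
  simpa only [flip_innerₗ] using! this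

theorem integral_fourierInv_mul_eq_flip {f g : ℝ → ℂ} (hf : Integrable f) (hg : Integrable g) :
    ∫ ξ, 𝓕⁻ f ξ * g ξ = ∫ x, f x * 𝓕⁻ g x := by
  rw [Real.fourierInv_eq_fourier_comp_neg, integral_fourier_mul_eq_flip hf.comp_neg hg,
    ← integral_neg_eq_self]
  simp_rw [neg_neg, Real.fourierInv_eq_fourier_neg]

theorem fourier_toLp_ae_eq {w : ℝ → ℂ} (h1 : Integrable w) (h2 : MemLp w 2) :
    (𝓕 (h2.toLp w) : Lp ℂ 2 (volume : Measure ℝ)) =ᵐ[volume] 𝓕 w := by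
  have hc : Continuous (𝓕 w) :=
    VectorFourier.fourierIntegral_continuous Real.continuous_fourierChar continuous_inner h1
  refine ae_eq_of_integral_contDiff_smul_eq
    ((Lp.memLp _).locallyIntegrable (by norm_num)) hc.locallyIntegrable ?_
  intro g hg hgs
  have hgs' : HasCompactSupport (fun x => (g x : ℂ)) := hgs.comp_left Complex.ofReal_zero
  let G : 𝓢(ℝ, ℂ) := hgs'.toSchwartzMap (Complex.ofRealCLM.contDiff.comp hg)
  have key := DFunLike.congr_fun (Lp.fourier_toTemperedDistribution_eq (h2.toLp w)) G
  rw [TemperedDistribution.fourier_apply, Lp.toTemperedDistribution_apply,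
    Lp.toTemperedDistribution_apply] at key
  have hG : ∀ x, G x = (g x : ℂ) := fun x => rfl
  calc ∫ x, g x • (𝓕 (h2.toLp w) : Lp ℂ 2 (volume : Measure ℝ)) x
      = ∫ x, G x • (𝓕 (h2.toLp w) : Lp ℂ 2 (volume : Measure ℝ)) x := by simp [hG]
    _ = ∫ x, (𝓕 G) x • (h2.toLp w) x := key.symm
    _ = ∫ x, 𝓕 (G : ℝ → ℂ) x * w x := by
        refine integral_congr_ae ?_
        filter_upwards [MemLp.coeFn_toLp h2] with x hx
        rw [hx, SchwartzMap.fourier_coe, smul_eq_mul]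
    _ = ∫ x, G x * 𝓕 w x := integral_fourier_mul_eq_flip G.integrable h1
    _ = ∫ x, g x • 𝓕 w x := by simp [hG]

theorem integral_norm_sq_fourier {w : ℝ → ℂ} (h1 : Integrable w) (h2 : MemLp w 2) :
    ∫ x, ‖𝓕 w x‖ ^ 2 = ∫ x, ‖w x‖ ^ 2 := by
  have hsq (f : Lp ℂ 2 (volume : Measure ℝ)) : ∫ x, ‖f x‖ ^ 2 = ‖f‖ ^ 2 := by
    have := L2.inner_def (𝕜 := ℂ) f f
    rw [inner_self_eq_norm_sq_to_K] at this
    have h' : ((∫ x, ‖f x‖ ^ 2 : ℝ) : ℂ) = ((‖f‖ ^ 2 : ℝ) : ℂ) := by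
      rw [← integral_complex_ofReal]
      push_cast
      simp only [inner_self_eq_norm_sq_to_K] at this
      exact this.symm
    exact_mod_cast h'
  have e1 := hsq (𝓕 (h2.toLp w))
  have e2 := hsq (h2.toLp w)
  rw [Lp.norm_fourier_eq, ← e2] at e1
  calc ∫ x, ‖𝓕 w x‖ ^ 2 = ∫ x, ‖(𝓕 (h2.toLp w) : Lp ℂ 2 (volume : Measure ℝ)) x‖ ^ 2 := by
        refine integral_congr_ae ?_
        filter_upwards [fourier_toLp_ae_eq h1 h2] with x hx
        rw [hx]
    _ = _ := e1
    _ = _ := by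
        refine integral_congr_ae ?_
        filter_upwards [MemLp.coeFn_toLp h2] with x hx
        rw [hx]

theorem integral_fourierInv_sq {w : ℝ → ℂ} (h1 : Integrable w) (h2 : MemLp w 2)
    (hw : ∀ ξ, w (-ξ) = conj (w ξ)) :
    ∫ x, (𝓕⁻ w x) ^ 2 = ∫ ξ, w ξ * conj (w ξ) := by
  have hreal (x : ℝ) : conj (𝓕⁻ w x) = 𝓕⁻ w x := by
    rw [Real.fourierInv_eq', ← integral_conj, ← integral_neg_eq_self]
    congr 1
    ext ξ
    rw [smul_eq_mul, smul_eq_mul, map_mul, hw, Complex.conj_conj, ← Complex.exp_conj]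
    simp [Complex.conj_ofNat]
  have hl (x : ℝ) : (𝓕⁻ w x) ^ 2 = ((‖𝓕⁻ w x‖ ^ 2 : ℝ) : ℂ) := by
    rw [Complex.ofReal_pow, ← Complex.mul_conj', hreal, sq]
  have hr (x : ℝ) : w x * conj (w x) = ((‖w x‖ ^ 2 : ℝ) : ℂ) := by
    rw [Complex.ofReal_pow, ← Complex.mul_conj']
  simp_rw [hl, hr, integral_complex_ofReal, Real.fourierInv_eq_fourier_neg]
  rw [integral_neg_eq_self (fun x => ‖𝓕 w x‖ ^ 2), integral_norm_sq_fourier h1 h2]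

theorem fourierInv_of_hasDerivAt {v v' : ℝ → ℂ} (hv : ∀ x, HasDerivAt v (v' x) x)
    (h : Integrable v) (h' : Integrable v') (x : ℝ) :
    𝓕⁻ v' x = -(2 * Real.pi * Complex.I * x) * 𝓕⁻ v x := by
  have e : deriv v = v' := funext fun x => (hv x).deriv
  have := congrFun (Real.fourier_deriv h (fun x => (hv x).differentiableAt) (e ▸ h')) (-x)
  rw [e] at this
  rw [Real.fourierInv_eq_fourier_neg, this, Real.fourierInv_eq_fourier_neg]
  simp

theorem hasDerivAt_abs_rpow_mul_self {a : ℝ} (ha : 0 ≤ a) (x : ℝ) :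
    HasDerivAt (fun x : ℝ => |x| ^ a * x) ((a + 1) * |x| ^ a) x := by
  rcases ha.eq_or_lt with rfl | ha
  · simpa using! hasDerivAt_id x
  rcases eq_or_ne x 0 with rfl | hx
  · rw [hasDerivAt_iff_tendsto_slope]
    have h : Filter.Tendsto (fun x : ℝ => |x| ^ a) (nhds 0) (nhds (|0| ^ a)) :=
      (continuous_abs.rpow_const (fun _ => Or.inr ha.le)).tendsto 0
    simp only [abs_zero, Real.zero_rpow ha.ne', mul_zero] at h ⊢
    refine (h.mono_left nhdsWithin_le_nhds).congr' ?_
    filter_upwards [self_mem_nhdsWithin] with y hy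
    have hy : y ≠ 0 := hy
    simp [slope_def_field, hy]
  · have h := ((hasDerivAt_abs hx).rpow_const (p := a) (Or.inl (abs_ne_zero.2 hx))).mul
      (hasDerivAt_id x)
    convert! h using 1
    have h2 : |x| ^ a = |x| ^ (a - 1) * |x| := by
      rw [← Real.rpow_add_one (abs_ne_zero.2 hx), sub_add_cancel]
    rw [id, h2]
    have h3 : (SignType.sign x : ℝ) * x = |x| := by
      rw [mul_comm, self_mul_sign]
    linear_combination (- a * |x| ^ (a - 1)) * h3

theorem integrable_abs_rpow_mul {α : ℝ} (hα : 0 ≤ α) (f : 𝓢(ℝ, ℂ)) :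
    Integrable (fun ξ : ℝ => ((|ξ| ^ α : ℝ) : ℂ) * f ξ) := by
  have hc : Continuous (fun ξ : ℝ => ((|ξ| ^ α : ℝ) : ℂ)) :=
    Complex.continuous_ofReal.comp (continuous_abs.rpow_const fun _ => Or.inr hα)
  refine ((f.integrable_pow_mul volume 0).add (f.integrable_pow_mul volume ⌈α⌉₊)).mono'
    (hc.mul f.continuous).aestronglyMeasurable (Filter.Eventually.of_forall fun ξ => ?_)
  have h : |ξ| ^ α ≤ 1 + |ξ| ^ ⌈α⌉₊ := by
    rcases le_total |ξ| 1 with h | h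
    · exact (Real.rpow_le_one (abs_nonneg _) h hα).trans (by simp [pow_nonneg])
    · calc |ξ| ^ α ≤ |ξ| ^ (⌈α⌉₊ : ℝ) := Real.rpow_le_rpow_of_exponent_le h (Nat.le_ceil α)
        _ = |ξ| ^ ⌈α⌉₊ := Real.rpow_natCast _ _
        _ ≤ _ := by simp
  rw [norm_mul, Complex.norm_real, Real.norm_of_nonneg (Real.rpow_nonneg (abs_nonneg _) _)]
  simpa [add_mul] using mul_le_mul_of_nonneg_right h (norm_nonneg (f ξ))

theorem abs_rpow_half_mul_self (α ξ : ℝ) : |ξ| ^ (α / 2) * |ξ| ^ (α / 2) = |ξ| ^ α := by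
  rw [← sq, ← Real.rpow_mul_natCast (abs_nonneg _)]
  simp

theorem memLp_two_abs_rpow_mul {α : ℝ} (hα : 0 ≤ α) (f : 𝓢(ℝ, ℂ)) :
    MemLp (fun ξ : ℝ => ((|ξ| ^ (α / 2) : ℝ) : ℂ) * f ξ) 2 := by
  rw [memLp_two_iff_integrable_sq_norm
    (integrable_abs_rpow_mul (by positivity) f).aestronglyMeasurable]
  refine (integrable_abs_rpow_mul hα (SchwartzMap.smulLeftCLM ℂ f f)).norm.congr
    (Filter.Eventually.of_forall fun ξ => ?_)
  simp only [SchwartzMap.smulLeftCLM_apply_apply f.hasTemperateGrowth, smul_eq_mul, norm_mul,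
    Complex.norm_real, ← abs_rpow_half_mul_self α ξ]
  ring

/-- Multiplication of a Schwartz function by the coordinate. -/
def mulX (f : 𝓢(ℝ, ℂ)) : 𝓢(ℝ, ℂ) := SchwartzMap.smulLeftCLM ℂ Complex.ofReal f

theorem mulX_apply (f : 𝓢(ℝ, ℂ)) (x : ℝ) : mulX f x = x * f x :=
  SchwartzMap.smulLeftCLM_apply_apply (by fun_prop) f x

/-- The derivative of a Schwartz function. -/
def derivS (f : 𝓢(ℝ, ℂ)) : 𝓢(ℝ, ℂ) := SchwartzMap.derivCLM ℂ ℂ f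

theorem hasDerivAt_derivS (f : 𝓢(ℝ, ℂ)) (x : ℝ) : HasDerivAt f (derivS f x) x :=
  f.hasDerivAt x

theorem derivS_mulX (f : 𝓢(ℝ, ℂ)) : derivS (mulX f) = f + mulX (derivS f) := by
  ext x
  refine (hasDerivAt_derivS (mulX f) x).unique ?_
  have h : (mulX f : ℝ → ℂ) = fun x : ℝ => (x : ℂ) * f x := funext (mulX_apply f)
  rw [h, add_apply, mulX_apply]
  simpa using! (hasDerivAt_id x).ofReal_comp.mul (hasDerivAt_derivS f x)

theorem fourierInv_derivS (f : 𝓢(ℝ, ℂ)) :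
    𝓕⁻ (derivS f) = -(2 * Real.pi * Complex.I) • mulX (𝓕⁻ f) := by
  ext x
  rw [smul_apply, mulX_apply, SchwartzMap.fourierInv_coe, SchwartzMap.fourierInv_coe,
    fourierInv_of_hasDerivAt (hasDerivAt_derivS f) f.integrable (derivS f).integrable, smul_eq_mul]
  ring

theorem derivS_fourierInv (f : 𝓢(ℝ, ℂ)) :
    derivS (𝓕⁻ f) = (2 * Real.pi * Complex.I) • 𝓕⁻ (mulX f) := by
  ext x
  have hi : Integrable (fun x : ℝ => x • f x) := by
    refine (mulX f).integrable.congr (Filter.Eventually.of_forall fun x => ?_)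
    simp [mulX_apply]
  have h1 := (Real.hasDerivAt_fourier f.integrable hi (-x)).scomp x (hasDerivAt_neg x)
  have h2 : (𝓕 (f : ℝ → ℂ)) ∘ Neg.neg = 𝓕⁻ f := by
    ext y
    rw [SchwartzMap.fourierInv_coe, Real.fourierInv_eq_fourier_neg, Function.comp]
  rw [h2] at h1
  rw [(hasDerivAt_derivS (𝓕⁻ f) x).unique h1, smul_apply, SchwartzMap.fourierInv_coe,
    Real.fourierInv_eq_fourier_neg]
  rw [Real.fourier_eq, Real.fourier_eq, ← integral_smul, ← integral_smul]
  congr 1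
  ext y
  simp [mulX_apply, Circle.smul_def]
  ring

theorem hasDerivAt_abs_rpow_mul_mulX {a : ℝ} (ha : 0 ≤ a) (f : 𝓢(ℝ, ℂ)) (ξ : ℝ) :
    HasDerivAt (fun ξ : ℝ => ((|ξ| ^ a : ℝ) : ℂ) * mulX f ξ)
      (((|ξ| ^ a : ℝ) : ℂ) * (((a + 1 : ℝ) : ℂ) • f + mulX (derivS f)) ξ) ξ := by
  have h := (hasDerivAt_abs_rpow_mul_self ha ξ).ofReal_comp.mul (hasDerivAt_derivS f ξ)
  convert! h using 1
  · ext x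
    simp [mulX_apply, mul_assoc]
  · simp [mulX_apply]
    ring

/-- The weighted integral `∫ |ξ|^α f(ξ) dξ` of a Schwartz function. -/
def wInt (α : ℝ) (f : 𝓢(ℝ, ℂ)) : ℂ := ∫ ξ : ℝ, ((|ξ| ^ α : ℝ) : ℂ) * f ξ

theorem wInt_add {α : ℝ} (hα : 0 ≤ α) (f g : 𝓢(ℝ, ℂ)) :
    wInt α (f + g) = wInt α f + wInt α g := by
  rw [wInt, wInt, wInt,
    ← integral_add (integrable_abs_rpow_mul hα f) (integrable_abs_rpow_mul hα g)]
  simp only [add_apply, mul_add]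

theorem wInt_smul (α : ℝ) (c : ℂ) (f : 𝓢(ℝ, ℂ)) : wInt α (c • f) = c * wInt α f := by
  rw [wInt, wInt, ← integral_const_mul]
  simp only [smul_apply, smul_eq_mul, mul_left_comm]

theorem wInt_mulX_derivS {α : ℝ} (hα : 0 ≤ α) (f : 𝓢(ℝ, ℂ)) :
    wInt α (mulX (derivS f)) = -(α + 1) * wInt α f := by
  have h : wInt α (((α + 1 : ℝ) : ℂ) • f + mulX (derivS f)) = 0 :=
    integral_eq_zero_of_hasDerivAt_of_integrable (hasDerivAt_abs_rpow_mul_mulX hα f)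
      (integrable_abs_rpow_mul hα _) (integrable_abs_rpow_mul hα _)
  rw [wInt_add hα, wInt_smul] at h
  push_cast at h
  linear_combination h

/-- The pointwise product of two Schwartz functions. -/
def mulS (f g : 𝓢(ℝ, ℂ)) : 𝓢(ℝ, ℂ) := SchwartzMap.smulLeftCLM ℂ f g

theorem mulS_apply (f g : 𝓢(ℝ, ℂ)) (x : ℝ) : mulS f g x = f x * g x :=
  SchwartzMap.smulLeftCLM_apply_apply f.hasTemperateGrowth g x

theorem derivS_mulS (f g : 𝓢(ℝ, ℂ)) :
    derivS (mulS f g) = mulS (derivS f) g + mulS f (derivS g) := by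
  ext x
  refine (hasDerivAt_derivS (mulS f g) x).unique ?_
  have h : (mulS f g : ℝ → ℂ) = fun x => f x * g x := funext (mulS_apply f g)
  rw [h, add_apply, mulS_apply, mulS_apply]
  exact (hasDerivAt_derivS f x).mul (hasDerivAt_derivS g x)

/-- A Hermitian pair consists of `f` and `g` with `f (-ξ) = g ξ` and `conj (f ξ) = g ξ`. -/
def HermPair (f g : 𝓢(ℝ, ℂ)) : Prop := ∀ ξ, f (-ξ) = g ξ ∧ conj (f ξ) = g ξ

theorem HermPair.mulX_derivS {f g : 𝓢(ℝ, ℂ)} (h : HermPair f g) :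
    HermPair (mulX (derivS f)) (mulX (derivS g)) := by
  intro ξ
  have h1 : HasDerivAt g (-derivS f (-ξ)) ξ := by
    have := (hasDerivAt_derivS f (-ξ)).scomp ξ (hasDerivAt_neg ξ)
    convert! this using 1
    · exact funext fun x => (h x).1.symm
    · simp
  have h2 : HasDerivAt g (conj (derivS f ξ)) ξ := by
    have := (hasDerivAt_derivS f ξ).star
    convert! this using 1
    exact funext fun x => (h x).2.symm
  have e1 := h1.unique (hasDerivAt_derivS g ξ)
  have e2 := h2.unique (hasDerivAt_derivS g ξ)
  rw [mulX_apply, mulX_apply, mulX_apply, map_mul, e2, ← e1, Complex.conj_ofReal]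
  simp

theorem HermPair.add {f g f' g' : 𝓢(ℝ, ℂ)} (h : HermPair f g) (h' : HermPair f' g') :
    HermPair (f + f') (g + g') := by
  intro ξ
  simp [(h ξ).1, (h ξ).2, (h' ξ).1, (h' ξ).2]

theorem HermPair.ofReal_smul {f g : 𝓢(ℝ, ℂ)} (h : HermPair f g) (c : ℝ) :
    HermPair ((c : ℂ) • f) ((c : ℂ) • g) := by
  intro ξ
  simp [(h ξ).1, (h ξ).2]

theorem HermPair.integral_fourierInv_sq {α : ℝ} (hα : 0 ≤ α) {f g : 𝓢(ℝ, ℂ)}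
    (h : HermPair f g) :
    ∫ x, (𝓕⁻ (fun ξ : ℝ => ((|ξ| ^ (α / 2) : ℝ) : ℂ) * f ξ) x) ^ 2 = wInt α (mulS f g) := by
  rw [_root_.integral_fourierInv_sq (integrable_abs_rpow_mul (by positivity) f)
    (memLp_two_abs_rpow_mul hα f), wInt]
  · congr 1
    ext ξ
    rw [mulS_apply, map_mul, Complex.conj_ofReal, (h ξ).2, ← abs_rpow_half_mul_self α ξ]
    push_cast
    ring
  · intro ξ
    rw [abs_neg, map_mul, Complex.conj_ofReal, (h ξ).1, (h ξ).2]

theorem HermPair.wInt_mulS_comm (α : ℝ) {f g f' g' : 𝓢(ℝ, ℂ)} (h : HermPair f g)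
    (h' : HermPair f' g') : wInt α (mulS f g') = wInt α (mulS g f') := by
  rw [wInt, wInt, ← integral_neg_eq_self]
  congr 1
  ext ξ
  have h1 := (h' (-ξ)).1
  rw [neg_neg] at h1
  rw [mulS_apply, mulS_apply, abs_neg, (h ξ).1, h1]

/-- A real Schwartz function, regarded as complex-valued. -/
def complexify (φ : 𝓢(ℝ, ℝ)) : 𝓢(ℝ, ℂ) := SchwartzMap.postcompCLM Complex.ofRealCLM φ

theorem complexify_apply (φ : 𝓢(ℝ, ℝ)) (x : ℝ) : complexify φ x = φ x := rfl

theorem derivS_complexify (φ : 𝓢(ℝ, ℝ)) (x : ℝ) : derivS (complexify φ) x = (deriv φ x : ℝ) :=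
  (hasDerivAt_derivS (complexify φ) x).unique (φ.hasDerivAt x).ofReal_comp

theorem hermPair_fourier_complexify (φ : 𝓢(ℝ, ℝ)) :
    HermPair (𝓕 (complexify φ)) (𝓕⁻ (complexify φ)) := by
  intro ξ
  rw [SchwartzMap.fourier_coe, SchwartzMap.fourierInv_coe]
  refine ⟨(Real.fourierInv_eq_fourier_neg _ _).symm, ?_⟩
  rw [Real.fourierInv_eq', Real.fourier_eq', ← integral_conj]
  congr 1
  ext x
  rw [smul_eq_mul, smul_eq_mul, map_mul, ← Complex.exp_conj, complexify_apply,
    Complex.conj_ofReal]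
  simp [Complex.conj_ofNat]

theorem Dop_schwartz (β : ℝ) (φ : 𝓢(ℝ, ℝ)) (x : ℝ) :
    Dop β (fun t => φ t) x
      = 𝓕⁻ (fun ξ : ℝ => ((|ξ| ^ β : ℝ) : ℂ) * (𝓕 (complexify φ)) ξ) x :=
  Dop_eq_fourierInv β _ x

theorem integral_mul_Dop {α : ℝ} (hα : 0 ≤ α) (φ : 𝓢(ℝ, ℝ)) (g : 𝓢(ℝ, ℂ)) :
    ∫ x, g x * Dop α (fun t => φ t) x = wInt α (mulS (𝓕⁻ g) (𝓕 (complexify φ))) := by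
  simp_rw [Dop_schwartz]
  rw [← integral_fourierInv_mul_eq_flip g.integrable (integrable_abs_rpow_mul hα _), wInt]
  congr 1
  ext ξ
  rw [mulS_apply, SchwartzMap.fourierInv_coe]
  ring

theorem fourierInv_mulX_derivS (f : 𝓢(ℝ, ℂ)) :
    𝓕⁻ (mulX (derivS f)) = -(𝓕⁻ f + mulX (derivS (𝓕⁻ f))) := by
  have hc : (2 * Real.pi * Complex.I : ℂ) ≠ 0 := Complex.two_pi_I_ne_zero
  have h := derivS_fourierInv (derivS f)
  have hs (c : ℂ) (g : 𝓢(ℝ, ℂ)) : derivS (c • g) = c • derivS g := map_smul _ _ _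
  rw [fourierInv_derivS, hs, derivS_mulX, neg_smul, ← smul_neg] at h
  exact (smul_right_injective _ hc h).symm

theorem mulX_mulX_derivS_derivS (f : 𝓢(ℝ, ℂ)) :
    mulX (mulX (derivS (derivS f)))
      = mulX (derivS (mulX (derivS f))) + (-1 : ℂ) • mulX (derivS f) := by
  ext x
  rw [derivS_mulX]
  simp only [mulX_apply, add_apply, smul_apply, smul_eq_mul]
  ring

theorem fourierInv_mulX_mulX_derivS_derivS (f : 𝓢(ℝ, ℂ)) :
    𝓕⁻ (mulX (mulX (derivS (derivS f)))) = (2 : ℂ) • 𝓕⁻ f + (3 : ℂ) • mulX (derivS (𝓕⁻ f))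
      + mulX (derivS (mulX (derivS (𝓕⁻ f)))) := by
  have hd (g h : 𝓢(ℝ, ℂ)) : mulX (derivS (-(g + h))) = -(mulX (derivS g) + mulX (derivS h)) := by
    simp only [mulX, derivS, map_neg, map_add]
  rw [mulX_mulX_derivS_derivS, FourierTransform.fourierInv_add, FourierTransform.fourierInv_smul,
    fourierInv_mulX_derivS, fourierInv_mulX_derivS, hd]
  module

theorem mulX_derivS_mulS (f g : 𝓢(ℝ, ℂ)) :
    mulX (derivS (mulS f g)) = mulS (mulX (derivS f)) g + mulS f (mulX (derivS g)) := by
  ext x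
  rw [derivS_mulS]
  simp only [mulX_apply, mulS_apply, add_apply]
  ring

theorem mulS_add_left (f g h : 𝓢(ℝ, ℂ)) : mulS (f + g) h = mulS f h + mulS g h := by
  ext x
  simp only [mulS_apply, add_apply, add_mul]

theorem mulS_add_right (f g h : 𝓢(ℝ, ℂ)) : mulS f (g + h) = mulS f g + mulS f h := by
  ext x
  simp only [mulS_apply, add_apply, mul_add]

theorem mulS_smul_left (c : ℂ) (f g : 𝓢(ℝ, ℂ)) : mulS (c • f) g = c • mulS f g := by
  ext x
  simp only [mulS_apply, smul_apply, smul_eq_mul, mul_assoc]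

theorem mulS_smul_right (c : ℂ) (f g : 𝓢(ℝ, ℂ)) : mulS f (c • g) = c • mulS f g := by
  ext x
  simp only [mulS_apply, smul_apply, smul_eq_mul, mul_left_comm]

theorem mulS_comm (f g : 𝓢(ℝ, ℂ)) : mulS f g = mulS g f := by
  ext x
  simp only [mulS_apply, mul_comm]

/-- `x D^{α/2} φ'` as an inverse Fourier transform. -/
theorem mul_Dop_deriv {α : ℝ} (hα : 0 ≤ α) (φ : 𝓢(ℝ, ℝ)) (x : ℝ) :
    x * Dop (α / 2) (deriv (fun t => φ t)) x
      = -𝓕⁻ (fun ξ : ℝ => ((|ξ| ^ (α / 2) : ℝ) : ℂ) * (((α / 2 + 1 : ℝ) : ℂ) • 𝓕 (complexify φ)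
        + mulX (derivS (𝓕 (complexify φ)))) ξ) x := by
  have hα' : 0 ≤ α / 2 := by positivity
  have hF (ξ : ℝ) : 𝓕 (fun t : ℝ => ((deriv (fun t => φ t) t : ℝ) : ℂ)) ξ
      = 2 * Real.pi * Complex.I * mulX (𝓕 (complexify φ)) ξ := by
    have h1 : (fun t : ℝ => ((deriv (fun t => φ t) t : ℝ) : ℂ)) = derivS (complexify φ) :=
      funext fun t => (derivS_complexify φ t).symm
    have h2 := DFunLike.congr_fun (fourierInv_derivS (complexify φ)) (-ξ)
    rw [smul_apply, mulX_apply, SchwartzMap.fourierInv_coe, SchwartzMap.fourierInv_coe,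
      Real.fourierInv_eq_fourier_neg, Real.fourierInv_eq_fourier_neg, neg_neg] at h2
    rw [h1, h2, mulX_apply, SchwartzMap.fourier_coe]
    simp
  rw [fourierInv_of_hasDerivAt (hasDerivAt_abs_rpow_mul_mulX hα' (𝓕 (complexify φ)))
    (integrable_abs_rpow_mul hα' _) (integrable_abs_rpow_mul hα' _), Dop_eq_fourierInv]
  simp_rw [hF]
  have h3 : 𝓕⁻ (fun ξ : ℝ => ((|ξ| ^ (α / 2) : ℝ) : ℂ)
        * (2 * Real.pi * Complex.I * mulX (𝓕 (complexify φ)) ξ)) x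
      = 2 * Real.pi * Complex.I
        * 𝓕⁻ (fun ξ : ℝ => ((|ξ| ^ (α / 2) : ℝ) : ℂ) * mulX (𝓕 (complexify φ)) ξ) x := by
    rw [Real.fourierInv_eq, Real.fourierInv_eq, ← integral_const_mul]
    congr 1
    ext ξ
    simp only [Circle.smul_def, smul_eq_mul]
    ring
  rw [h3]
  ring

/-- **Fractional integration by parts** (Lemma A.1): for `α ≥ 0` and a Schwartz function
`φ : ℝ → ℝ`:
(i) `∫ φ D^α φ = ∫ (D^{α/2}φ)²`;
(ii) `∫ x φ' D^α φ = ((α−1)/2) ∫ (D^{α/2}φ)²`;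
(iii) `∫ x² φ'' D^α φ = −∫ x² (D^{α/2}φ')² + ((α−2)²/4) ∫ (D^{α/2}φ)²`. -/
theorem fractional_integration_by_parts (α : ℝ) (hα : 0 ≤ α) (φ : SchwartzMap ℝ ℝ) :
    (∫ x : ℝ, (φ x : ℂ) * Dop α (fun t => φ t) x
      = ∫ x : ℝ, (Dop (α / 2) (fun t => φ t) x) ^ 2) ∧
    (∫ x : ℝ, ((x : ℂ) * (deriv (fun t => φ t) x : ℂ)) * Dop α (fun t => φ t) x
      = (((α - 1) / 2 : ℝ) : ℂ) * ∫ x : ℝ, (Dop (α / 2) (fun t => φ t) x) ^ 2) ∧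
    (∫ x : ℝ, (((x ^ 2 : ℝ) : ℂ) * (deriv (deriv (fun t => φ t)) x : ℂ))
        * Dop α (fun t => φ t) x
      = -(∫ x : ℝ, ((x ^ 2 : ℝ) : ℂ) * (Dop (α / 2) (deriv (fun t => φ t)) x) ^ 2)
        + ((((α - 2) ^ 2 / 4 : ℝ)) : ℂ) * ∫ x : ℝ, (Dop (α / 2) (fun t => φ t) x) ^ 2) := by
  set ψ := 𝓕 (complexify φ) with hψ
  set η := 𝓕⁻ (complexify φ) with hη
  have hp : HermPair ψ η := hermPair_fourier_complexify φ
  have hN : ∫ x : ℝ, (Dop (α / 2) (fun t => φ t) x) ^ 2 = wInt α (mulS η ψ) := by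
    simp_rw [Dop_schwartz]
    rw [hp.integral_fourierInv_sq hα, mulS_comm]
  have hsymm : wInt α (mulS (mulX (derivS η)) ψ) = wInt α (mulS η (mulX (derivS ψ))) := by
    rw [mulS_comm]
    exact hp.wInt_mulS_comm α hp.mulX_derivS
  have ibp₁ := wInt_mulX_derivS hα (mulS η ψ)
  have ibp₂ := wInt_mulX_derivS hα (mulS (mulX (derivS η)) ψ)
  rw [mulX_derivS_mulS, wInt_add hα] at ibp₁ ibp₂
  rw [hN]
  refine ⟨integral_mul_Dop hα φ (complexify φ), ?_, ?_⟩
  · have h (x : ℝ) : (x : ℂ) * (deriv (fun t => φ t) x : ℂ) = mulX (derivS (complexify φ)) x := by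
      rw [mulX_apply]
      rfl
    simp_rw [h]
    rw [integral_mul_Dop hα, fourierInv_mulX_derivS, ← neg_one_smul ℂ, mulS_smul_left, wInt_smul,
      mulS_add_left, wInt_add hα, ← hψ, ← hη]
    push_cast
    linear_combination (-1 / 2 : ℂ) * ibp₁ - (1 / 2 : ℂ) * hsymm
  · have h (x : ℝ) : ((x ^ 2 : ℝ) : ℂ) * (deriv (deriv (fun t => φ t)) x : ℂ)
        = mulX (mulX (derivS (derivS (complexify φ)))) x := by
      rw [mulX_apply, mulX_apply, ← mul_assoc, ← sq, ← Complex.ofReal_pow]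
      rfl
    have h' (x : ℝ) : ((x ^ 2 : ℝ) : ℂ) * (Dop (α / 2) (deriv (fun t => φ t)) x) ^ 2
        = (𝓕⁻ (fun ξ : ℝ => ((|ξ| ^ (α / 2) : ℝ) : ℂ)
          * (((α / 2 + 1 : ℝ) : ℂ) • ψ + mulX (derivS ψ)) ξ) x) ^ 2 := by
      rw [Complex.ofReal_pow, ← mul_pow, mul_Dop_deriv hα, neg_sq]
    simp_rw [h, h']
    rw [integral_mul_Dop hα, fourierInv_mulX_mulX_derivS_derivS,
      ((hp.ofReal_smul _).add hp.mulX_derivS).integral_fourierInv_sq hα, mulS_comm (_ + _) (_ + _)]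
    simp only [mulS_add_left, mulS_add_right, mulS_smul_left, mulS_smul_right, wInt_add hα,
      wInt_smul, ← hψ, ← hη]
    push_cast
    linear_combination ibp₂ + 2 * ibp₁ + (1 - α / 2 : ℂ) * hsymm
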